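/- arXiv:2304.05808 — 3 statements merged into one kernel-verified Lean document; each statement's English description precedes it below -/
import Mathlib

section
/- Let n ≥ 3 and let g(x', x_n) = c(x', x_n)·blockdiag(ĝ(x'), 1) on ℝ^n as in the setup. Let u ∈ C²(ℝ^{n−1}), regarded as a function on ℝ^n independent of x_n. Then at every point x = (x', x_n) ∈ ℝ^n: Δ_g u = c^{-1} Δ_ĝ u − ((2−n)/(2c²)) Σ_{m,r=1}^{n−1} ĝ^{mr} ∂_{x_r}c ∂_{x_m}u, where Δ_g u = g^{ij}(∂²_{x_i x_j}u − Γ(g)^m_{ij}∂_{x_m}u) (indices 1..n) and Δ_ĝ u = ĝ^{ij}(∂²_{x_i x_j}u − Γ(ĝ)^m_{ij}∂_{x_m}u) (indices 1..n−1). -/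
noncomputable section

open scoped BigOperators

/-- Partial derivative `∂_i f` at `x`. -/
def pd {k : ℕ} {E : Type*} [NormedAddCommGroup E] [NormedSpace ℝ E]
    (i : Fin k) (f : (Fin k → ℝ) → E) (x : Fin k → ℝ) : E :=
  fderiv ℝ f x (Pi.single i 1)

/-- Christoffel symbols `Γ(h)^m_{ij} = ½ h^{ml}(∂_i h_{jl} + ∂_j h_{il} − ∂_l h_{ij})`. -/
def christoffel {k : ℕ} (h : (Fin k → ℝ) → Matrix (Fin k) (Fin k) ℝ)
    (m i j : Fin k) (x : Fin k → ℝ) : ℝ :=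
  (1 / 2) * ∑ l : Fin k, (h x)⁻¹ m l *
    (pd i (fun y => h y j l) x + pd j (fun y => h y i l) x - pd l (fun y => h y i j) x)

/-- Laplace–Beltrami operator `Δ_h f = h^{ij}(∂²_{ij} f − Γ(h)^m_{ij} ∂_m f)`. -/
def laplaceB {k : ℕ} (h : (Fin k → ℝ) → Matrix (Fin k) (Fin k) ℝ)
    (f : (Fin k → ℝ) → ℝ) (x : Fin k → ℝ) : ℝ :=
  ∑ i : Fin k, ∑ j : Fin k, (h x)⁻¹ i j *
    (pd i (pd j f) x - ∑ l : Fin k, christoffel h l i j x * pd l f x)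

/-- Hessian `(∇²_h f)_{ij} = ∂²_{ij} f − Γ(h)^m_{ij} ∂_m f`. -/
def hessian {k : ℕ} (h : (Fin k → ℝ) → Matrix (Fin k) (Fin k) ℝ)
    (f : (Fin k → ℝ) → ℝ) (i j : Fin k) (x : Fin k → ℝ) : ℝ :=
  pd i (pd j f) x - ∑ l : Fin k, christoffel h l i j x * pd l f x

/-- Gradient components `(∇_h f)^i = h^{ij} ∂_j f`. -/
def gradC {k : ℕ} (h : (Fin k → ℝ) → Matrix (Fin k) (Fin k) ℝ)
    (f : (Fin k → ℝ) → ℝ) (i : Fin k) (x : Fin k → ℝ) : ℝ :=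
  ∑ j : Fin k, (h x)⁻¹ i j * pd j f x

/-- Squared gradient norm `|∇_h f|²_h = h^{ij} ∂_i f ∂_j f`. -/
def gradSq {k : ℕ} (h : (Fin k → ℝ) → Matrix (Fin k) (Fin k) ℝ)
    (f : (Fin k → ℝ) → ℝ) (x : Fin k → ℝ) : ℝ :=
  ∑ i : Fin k, ∑ j : Fin k, (h x)⁻¹ i j * pd i f x * pd j f x

/-- Divergence `div_h a = Σ_i (∂_i a^i + Σ_j a^j Γ(h)^i_{ij})`. -/
def divg {k : ℕ} (h : (Fin k → ℝ) → Matrix (Fin k) (Fin k) ℝ)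
    (a : Fin k → (Fin k → ℝ) → ℝ) (x : Fin k → ℝ) : ℝ :=
  ∑ i : Fin k, (pd i (a i) x + ∑ j : Fin k, a j x * christoffel h i i j x)

/-- The projection `x ↦ x'` onto the first `m` coordinates. -/
def proj {m : ℕ} (x : Fin (m + 1) → ℝ) : Fin m → ℝ := x ∘ Fin.castSucc

/-- The metric `g(x', x_n) = c(x', x_n) · blockdiag(ĝ(x'), 1)` on `ℝ^{m+1}`. -/
def gMet {m : ℕ} (c : (Fin (m + 1) → ℝ) → ℝ)
    (ghat : (Fin m → ℝ) → Matrix (Fin m) (Fin m) ℝ)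
    (x : Fin (m + 1) → ℝ) : Matrix (Fin (m + 1)) (Fin (m + 1)) ℝ :=
  Matrix.of fun i j =>
    c x * (if hi : (i : ℕ) < m then
             (if hj : (j : ℕ) < m then ghat (proj x) ⟨i, hi⟩ ⟨j, hj⟩ else 0)
           else (if (j : ℕ) < m then 0 else 1))

/-- A function `u` on `ℝ^m`, regarded as a function on `ℝ^{m+1}` independent of the last
coordinate. -/
def ext {m : ℕ} (u : (Fin m → ℝ) → ℝ) (x : Fin (m + 1) → ℝ) : ℝ := u (proj x)

section helpers
variable {m : ℕ}

lemma gMet_cc (c : (Fin (m + 1) → ℝ) → ℝ) (G : (Fin m → ℝ) → Matrix (Fin m) (Fin m) ℝ) (x) (i j : Fin m) :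
    gMet c G x i.castSucc j.castSucc = c x * G (proj x) i j := by
  simp [gMet]

lemma gMet_cl (c : (Fin (m + 1) → ℝ) → ℝ) (G : (Fin m → ℝ) → Matrix (Fin m) (Fin m) ℝ) (x) (i : Fin m) :
    gMet c G x i.castSucc (Fin.last m) = 0 := by
  simp [gMet]

lemma gMet_lc (c : (Fin (m + 1) → ℝ) → ℝ) (G : (Fin m → ℝ) → Matrix (Fin m) (Fin m) ℝ) (x) (i : Fin m) :
    gMet c G x (Fin.last m) i.castSucc = 0 := by
  simp [gMet]

lemma gMet_ll (c : (Fin (m + 1) → ℝ) → ℝ) (G : (Fin m → ℝ) → Matrix (Fin m) (Fin m) ℝ) (x) :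
    gMet c G x (Fin.last m) (Fin.last m) = c x := by
  simp [gMet]

lemma gMet_inv (c : (Fin (m + 1) → ℝ) → ℝ) (G : (Fin m → ℝ) → Matrix (Fin m) (Fin m) ℝ) (x)
    (hc : c x ≠ 0) (hG : G (proj x) * (G (proj x))⁻¹ = 1) :
    (gMet c G x)⁻¹ = gMet (fun y => (c y)⁻¹) (fun y => (G y)⁻¹) x := by
  apply Matrix.inv_eq_right_inv
  ext i j
  rw [Matrix.mul_apply, Fin.sum_univ_castSucc]
  refine Fin.lastCases ?_ (fun i => ?_) i <;> refine Fin.lastCases ?_ (fun j => ?_) j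
  · simp [gMet_ll, gMet_lc, gMet_cl, hc]
  · simp [gMet_ll, gMet_lc, (Fin.castSucc_lt_last j).ne']
  · simp [gMet_ll, gMet_cl, (Fin.castSucc_lt_last i).ne]
  · simp only [gMet_cc, gMet_cl, gMet_lc, mul_zero, add_zero]
    have := congrFun (congrFun hG i) j
    rw [Matrix.mul_apply] at this
    rw [Matrix.one_apply] at this ⊢
    simp only [Fin.castSucc_inj]
    rw [← this]
    refine Finset.sum_congr rfl fun k _ => ?_
    field_simp

def projL (m : ℕ) : (Fin (m + 1) → ℝ) →L[ℝ] (Fin m → ℝ) :=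
  ContinuousLinearMap.pi fun i => ContinuousLinearMap.proj i.castSucc

lemma proj_hasFDerivAt (x : Fin (m + 1) → ℝ) : HasFDerivAt (proj (m := m)) (projL m) x :=
  (projL m).hasFDerivAt

lemma projL_c (i : Fin m) : projL m (Pi.single i.castSucc 1) = Pi.single i 1 := by
  ext j
  simp [projL, Pi.single_apply]

lemma projL_l : projL m (Pi.single (Fin.last m) 1) = 0 := by
  ext j
  simp [projL, Pi.single_apply, (Fin.castSucc_lt_last j).ne]

lemma pd_proj_c (f : (Fin m → ℝ) → ℝ) (x) (hf : DifferentiableAt ℝ f (proj x)) (i : Fin m) :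
    pd i.castSucc (fun y => f (proj y)) x = pd i f (proj x) := by
  have := (hf.hasFDerivAt.comp x (proj_hasFDerivAt x)).fderiv
  unfold pd
  change fderiv ℝ (f ∘ proj) x _ = _
  rw [this]; simp [projL_c]

lemma pd_proj_l (f : (Fin m → ℝ) → ℝ) (x) (hf : DifferentiableAt ℝ f (proj x)) :
    pd (Fin.last m) (fun y => f (proj y)) x = 0 := by
  have := (hf.hasFDerivAt.comp x (proj_hasFDerivAt x)).fderiv
  unfold pd
  change fderiv ℝ (f ∘ proj) x _ = _
  rw [this]; simp [projL_l]

lemma pd_mul' {k : ℕ} (i : Fin k) (f g : (Fin k → ℝ) → ℝ) (x) (hf : DifferentiableAt ℝ f x)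
    (hg : DifferentiableAt ℝ g x) :
    pd i (fun y => f y * g y) x = pd i f x * g x + f x * pd i g x := by
  unfold pd
  rw [fderiv_fun_mul hf hg]
  simp; ring

lemma pd_zero' {k : ℕ} (i : Fin k) (x) : pd i (fun _ : Fin k → ℝ => (0:ℝ)) x = 0 := by
  simp [pd]

lemma key (A G : Matrix (Fin m) (Fin m) ℝ) (hs : ∀ i j, G i j = G j i) (h1 : A * G = 1)
    (h2 : G * A = 1) (d : Fin m → ℝ) (l : Fin m) :
    ∑ i, ∑ j, A i j * ∑ k, A l k * (d i * G j k + d j * G i k - d k * G i j)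
      = (2 - (m:ℝ)) * ∑ k, A l k * d k := by
  have e1 : ∀ i k, ∑ j, A i j * G j k = if i = k then 1 else 0 := fun i k => by
    rw [← Matrix.mul_apply, h1, Matrix.one_apply]
  have e2 : ∀ k j, ∑ i, A i j * G i k = if k = j then 1 else 0 := fun k j => by
    rw [← Matrix.one_apply, ← h2, Matrix.mul_apply]
    exact Finset.sum_congr rfl fun i _ => by rw [hs, mul_comm]
  have e3 : ∑ i, ∑ j, A i j * G i j = m := by
    calc _ = ∑ i : Fin m, ∑ j, A i j * G j i := by
            refine Finset.sum_congr rfl fun i _ => Finset.sum_congr rfl fun j _ => by rw [hs]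
      _ = _ := by simp [e1]
  have a1 : ∑ i, ∑ j, A i j * ∑ k, A l k * (d i * G j k) = ∑ k, A l k * d k := by
    calc _ = ∑ i, ∑ k, (A l k * d i) * ∑ j, A i j * G j k := by
          refine Finset.sum_congr rfl fun i _ => ?_
          simp only [Finset.mul_sum]
          rw [Finset.sum_comm]
          refine Finset.sum_congr rfl fun k _ => Finset.sum_congr rfl fun j _ => by ring
      _ = _ := by simp [e1]
  have a2 : ∑ i, ∑ j, A i j * ∑ k, A l k * (d j * G i k) = ∑ k, A l k * d k := by
    rw [Finset.sum_comm]
    calc _ = ∑ j, ∑ k, (A l k * d j) * ∑ i, A i j * G i k := by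
          refine Finset.sum_congr rfl fun i _ => ?_
          simp only [Finset.mul_sum]
          rw [Finset.sum_comm]
          refine Finset.sum_congr rfl fun k _ => Finset.sum_congr rfl fun j _ => by ring
      _ = _ := by simp [e2]
  have a3 : ∑ i, ∑ j, A i j * ∑ k, A l k * (d k * G i j) = m * ∑ k, A l k * d k := by
    rw [← e3, Finset.sum_mul]
    refine Finset.sum_congr rfl fun i _ => ?_
    rw [Finset.sum_mul]
    refine Finset.sum_congr rfl fun j _ => ?_
    rw [mul_assoc, Finset.mul_sum (a := G i j)]
    congr 1
    refine Finset.sum_congr rfl fun j _ => by ring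
  calc _ = ∑ i, ∑ j, A i j * ∑ k, A l k * (d i * G j k) + ∑ i, ∑ j, A i j * ∑ k, A l k * (d j * G i k)
        - ∑ i, ∑ j, A i j * ∑ k, A l k * (d k * G i j) := by
        simp only [mul_add, mul_sub, Finset.sum_add_distrib, Finset.sum_sub_distrib]
    _ = _ := by rw [a1, a2, a3]; ring

end helpers

/-- For `u ∈ C²(ℝ^{n−1})` regarded as a function on `ℝ^n` independent of `x_n`,
`Δ_g u = c⁻¹ Δ_ĝ u − ((2−n)/(2c²)) Σ_{m,r} ĝ^{mr} ∂_r c ∂_m u`, where `n = m+1`. -/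
theorem laplaceB_gMet_ext (m : ℕ) (hm : 2 ≤ m)
    (ghat : (Fin m → ℝ) → Matrix (Fin m) (Fin m) ℝ)
    (hghat : ∀ i j, ContDiff ℝ (⊤ : ℕ∞) fun x' => ghat x' i j)
    (hpd : ∀ x', (ghat x').PosDef)
    (c : (Fin (m + 1) → ℝ) → ℝ)
    (hc : ContDiff ℝ (⊤ : ℕ∞) c) (hcpos : ∀ x, 0 < c x)
    (u : (Fin m → ℝ) → ℝ) (hu : ContDiff ℝ 2 u)
    (x : Fin (m + 1) → ℝ) :
    laplaceB (gMet c ghat) (ext u) x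
      = (c x)⁻¹ * laplaceB ghat u (proj x)
        - ((2 - ((m : ℝ) + 1)) / (2 * c x ^ 2)) *
            ∑ mm : Fin m, ∑ r : Fin m,
              (ghat (proj x))⁻¹ mm r * pd (Fin.castSucc r) c x * pd mm u (proj x) := by
  have hcd : Differentiable ℝ c := hc.differentiable (by simp)
  have hGd : ∀ i j, Differentiable ℝ (fun y => ghat y i j) :=
    fun i j => (hghat i j).differentiable (by simp)
  have hGpd : ∀ i j, DifferentiableAt ℝ (fun y => ghat (proj y) i j) x := fun i j =>
    (hGd i j (proj x)).comp x (proj_hasFDerivAt x).differentiableAt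
  have hud : Differentiable ℝ u := hu.differentiable (by simp)
  have hud2 : ∀ j, Differentiable ℝ (pd j u) := fun j =>
    ((hu.fderiv_right (m := 1) (by norm_num)).clm_apply contDiff_const).differentiable (by simp)
  have hdet : IsUnit (ghat (proj x)).det := (hpd (proj x)).det_pos.ne'.isUnit
  have hGA := Matrix.mul_nonsing_inv _ hdet
  have hAG := Matrix.nonsing_inv_mul _ hdet
  have hsym : ∀ i j, ghat (proj x) i j = ghat (proj x) j i := fun i j => by
    simpa using (hpd (proj x)).isHermitian.apply j i
  have hc0 : c x ≠ 0 := (hcpos x).ne'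
  have u1 : ∀ j : Fin m, pd j.castSucc (ext u) = fun y => pd j u (proj y) := fun j =>
    funext fun y => pd_proj_c u y (hud _) j
  have u2 : pd (Fin.last m) (ext u) = fun _ => 0 := funext fun y => pd_proj_l u y (hud _)
  have inv := gMet_inv c ghat x hc0 hGA
  have dcc : ∀ i j k : Fin m, pd i.castSucc (fun y => gMet c ghat y j.castSucc k.castSucc) x
      = pd i.castSucc c x * ghat (proj x) j k + c x * pd i (fun y => ghat y j k) (proj x) := by
    intro i j k
    simp only [gMet_cc]
    rw [pd_mul' _ _ _ _ (hcd x) (hGpd j k), pd_proj_c (fun y => ghat y j k) x (hGd j k _)]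
  have gam : ∀ l i j : Fin m, christoffel (gMet c ghat) l.castSucc i.castSucc j.castSucc x
      = christoffel ghat l i j (proj x) + (2 * c x)⁻¹ * ∑ k, (ghat (proj x))⁻¹ l k *
        (pd i.castSucc c x * ghat (proj x) j k + pd j.castSucc c x * ghat (proj x) i k
          - pd k.castSucc c x * ghat (proj x) i j) := by
    intro l i j
    unfold christoffel
    rw [inv, Fin.sum_univ_castSucc]
    simp only [gMet_cc c ghat, gMet_cl (fun y => (c y)⁻¹), zero_mul, add_zero, dcc,
      gMet_cc (fun y => (c y)⁻¹)] 
    simp only [← gMet_cc c ghat, dcc]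
    simp only [Finset.mul_sum, ← Finset.sum_add_distrib]
    refine Finset.sum_congr rfl fun k _ => ?_
    field_simp
    ring
  have gamn : ∀ l : Fin m, christoffel (gMet c ghat) l.castSucc (Fin.last m) (Fin.last m) x
      = - ((2 * c x)⁻¹ * ∑ k, (ghat (proj x))⁻¹ l k * pd k.castSucc c x) := by
    intro l
    unfold christoffel
    rw [inv, Fin.sum_univ_castSucc]
    simp only [gMet_cl, gMet_lc, gMet_ll, zero_mul, add_zero, pd_zero', gMet_cc]
    simp only [Finset.mul_sum, ← Finset.sum_neg_distrib]
    refine Finset.sum_congr rfl fun k _ => ?_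
    field_simp
    ring
  have K := fun l => key _ _ hsym hAG hGA (fun k : Fin m => pd k.castSucc c x) l
  unfold laplaceB
  rw [inv]
  simp only [Fin.sum_univ_castSucc, gMet_cl, gMet_lc, gMet_ll, gMet_cc, zero_mul, add_zero,
    Finset.sum_const_zero, zero_add, u1, u2, pd_zero', mul_zero, gam, gamn]
  simp only [fun i j => pd_proj_c (pd j u) x (hud2 j _) i]
  set A := (ghat (proj x))⁻¹
  set G := ghat (proj x)
  set W := fun i j l : Fin m => ∑ k, A l k * (pd i.castSucc c x * G j k + pd j.castSucc c x * G i k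
          - pd k.castSucc c x * G i j) with hW
  have R : ∑ mm : Fin m, ∑ r : Fin m, A mm r * pd (Fin.castSucc r) c x * pd mm u (proj x)
      = ∑ l, (∑ k, A l k * pd k.castSucc c x) * pd l u (proj x) := by
    simp only [Finset.sum_mul]
  have S : ∑ i, ∑ j, A i j * ∑ l, W i j l * pd l u (proj x)
      = (2 - (m:ℝ)) * ∑ l, (∑ k, A l k * pd k.castSucc c x) * pd l u (proj x) := by
    calc _ = ∑ l, (∑ i, ∑ j, A i j * W i j l) * pd l u (proj x) := by
          trans ∑ i, ∑ l, ∑ j, A i j * W i j l * pd l u (proj x)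
          · refine Finset.sum_congr rfl fun i _ => ?_
            rw [Finset.sum_comm]
            refine Finset.sum_congr rfl fun j _ => ?_
            rw [Finset.mul_sum]
            refine Finset.sum_congr rfl fun l _ => by ring
          · rw [Finset.sum_comm]
            simp only [Finset.sum_mul]
      _ = _ := by
          rw [Finset.mul_sum]
          refine Finset.sum_congr rfl fun l _ => ?_
          rw [← mul_assoc, ← K l]
  have T : ∑ i, ∑ j, (c x)⁻¹ * A i j * (pd i (pd j u) (proj x)
        - ∑ l, (christoffel ghat l i j (proj x) + (2 * c x)⁻¹ * W i j l) * pd l u (proj x))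
      = (c x)⁻¹ * ∑ i, ∑ j, A i j * (pd i (pd j u) (proj x)
        - ∑ l, christoffel ghat l i j (proj x) * pd l u (proj x))
        - (c x)⁻¹ * (2 * c x)⁻¹ * ∑ i, ∑ j, A i j * ∑ l, W i j l * pd l u (proj x) := by
    rw [Finset.mul_sum, Finset.mul_sum, ← Finset.sum_sub_distrib]
    refine Finset.sum_congr rfl fun i _ => ?_
    rw [Finset.mul_sum, Finset.mul_sum, ← Finset.sum_sub_distrib]
    refine Finset.sum_congr rfl fun j _ => ?_
    simp only [add_mul, Finset.sum_add_distrib, mul_assoc, ← Finset.mul_sum]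
    ring
  have N : ∑ l : Fin m, -((2 * c x)⁻¹ * ∑ k : Fin m, A l k * pd k.castSucc c x) * pd l u (proj x)
      = - ((2 * c x)⁻¹ * ∑ l, (∑ k, A l k * pd k.castSucc c x) * pd l u (proj x)) := by
    simp only [Finset.mul_sum (a := (2 * c x)⁻¹), ← Finset.sum_neg_distrib, Finset.sum_mul]
    refine Finset.sum_congr rfl fun i _ => Finset.sum_congr rfl fun j _ => by ring
  rw [R, T, S, N]
  field_simp
  ring
end
end

section
/- Let n ≥ 3 and let g(x', x_n) = c(x', x_n)·blockdiag(ĝ(x'), 1) on ℝ^n as in the setup. Let u ∈ C²(ℝ^{n−1}) and set f(x', x_n) := x_n − u(x'). Then at every point x = (x', x_n) ∈ ℝ^n: c(x)² (∇²_g f)(∇_g f, ∇_g f)(x) = (1/(2c(x))) Σ_{m,r=1}^{n−1} ĝ^{mr}(x') ∂_{x_r}c(x) ∂_{x_m}u(x') − (1/(2c(x))) ∂_{x_n}c(x)(1 + |∇_ĝ u(x')|²_ĝ) − (∇²_g u)(∇_ĝ u, ∇_ĝ u)(x), where (∇²_g u)(∇_ĝ u, ∇_ĝ u) = (∂²_{x_i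 x_j}u − Γ(g)^m_{ij}∂_{x_m}u) ĝ^{ia}∂_{x_a}u ĝ^{jb}∂_{x_b}u with i, j, a, b summed from 1 to n−1 and m from 1 to n. -/
noncomputable section

open scoped BigOperators

theorem aux_pd_ext_cast {m : ℕ} (u : (Fin m → ℝ) → ℝ) (hu : Differentiable ℝ u) (i : Fin m)
    (y : Fin (m + 1) → ℝ) : pd (Fin.castSucc i) (fun y => u (proj y)) y = pd i u (proj y) := by
  let L : (Fin (m + 1) → ℝ) →L[ℝ] (Fin m → ℝ) :=
    ContinuousLinearMap.pi fun j => ContinuousLinearMap.proj (Fin.castSucc j)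
  have h1 : HasFDerivAt (fun y : Fin (m + 1) → ℝ => u (proj y))
      ((fderiv ℝ u (proj y)).comp L) y :=
    HasFDerivAt.comp (f := fun y : Fin (m + 1) → ℝ => (proj y : Fin m → ℝ)) y
      (hu (proj y)).hasFDerivAt L.hasFDerivAt
  unfold pd
  rw [h1.fderiv, ContinuousLinearMap.comp_apply]
  congr 1
  ext j
  simp [L, Pi.single_apply]

theorem aux_pd_ext_last {m : ℕ} (u : (Fin m → ℝ) → ℝ) (hu : Differentiable ℝ u)
    (y : Fin (m + 1) → ℝ) : pd (Fin.last m) (fun y => u (proj y)) y = 0 := by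
  let L : (Fin (m + 1) → ℝ) →L[ℝ] (Fin m → ℝ) :=
    ContinuousLinearMap.pi fun j => ContinuousLinearMap.proj (Fin.castSucc j)
  have h1 : HasFDerivAt (fun y : Fin (m + 1) → ℝ => u (proj y))
      ((fderiv ℝ u (proj y)).comp L) y :=
    HasFDerivAt.comp (f := fun y : Fin (m + 1) → ℝ => (proj y : Fin m → ℝ)) y
      (hu (proj y)).hasFDerivAt L.hasFDerivAt
  unfold pd
  rw [h1.fderiv, ContinuousLinearMap.comp_apply]
  have : L (Pi.single (Fin.last m) 1) = 0 := by
    ext j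
    simp [L, Pi.single_apply, Fin.castSucc_ne_last]
  rw [this, map_zero]

theorem aux_diff_ext {m : ℕ} (u : (Fin m → ℝ) → ℝ) (hu : Differentiable ℝ u) :
    Differentiable ℝ (fun y : Fin (m + 1) → ℝ => u (proj y)) := by
  apply hu.comp
  unfold proj
  exact differentiable_pi.2 fun j => differentiable_apply _

theorem aux_christ {k : ℕ} (h : (Fin k → ℝ) → Matrix (Fin k) (Fin k) ℝ) (x : Fin k → ℝ)
    (F v : Fin k → ℝ) (s : ℝ) (hF : ∀ a, ∑ l, (h x)⁻¹ l a * F l = s * v a) :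
    ∑ i, ∑ j, (∑ l, christoffel h l i j x * F l) * v i * v j
      = s / 2 * ∑ l, ∑ i, ∑ j, pd l (fun y => h y i j) x * v i * v j * v l := by
  set D : Fin k → Fin k → Fin k → ℝ := fun l i j => pd l (fun y => h y i j) x with hD
  have e1 : ∀ i j, ∑ l, christoffel h l i j x * F l
      = s / 2 * ∑ a, v a * (D i j a + D j i a - D a i j) := by
    intro i j
    simp only [christoffel]
    calc _ = ∑ l, ∑ a, (1/2) * ((h x)⁻¹ l a * F l) * (D i j a + D j i a - D a i j) := by
          refine Finset.sum_congr rfl fun l _ => ?_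
          rw [Finset.mul_sum, Finset.sum_mul]
          refine Finset.sum_congr rfl fun a _ => ?_
          simp only [hD]; ring
      _ = _ := by
          rw [Finset.sum_comm, Finset.mul_sum]
          refine Finset.sum_congr rfl fun a _ => ?_
          rw [← Finset.sum_mul, ← Finset.mul_sum, hF]; ring
  have e2 : ∑ i, ∑ j, ∑ a, D i j a * v i * v j * v a
      = ∑ l, ∑ i, ∑ j, D l i j * v i * v j * v l := by
    refine Finset.sum_congr rfl fun l _ => Finset.sum_congr rfl fun i _ =>
      Finset.sum_congr rfl fun j _ => by ring
  have e3 : ∑ i, ∑ j, ∑ a, D j i a * v i * v j * v a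
      = ∑ l, ∑ i, ∑ j, D l i j * v i * v j * v l := by
    rw [Finset.sum_comm]
    refine Finset.sum_congr rfl fun l _ => Finset.sum_congr rfl fun i _ =>
      Finset.sum_congr rfl fun j _ => by ring
  have e4 : ∑ i, ∑ j, ∑ a, D a i j * v i * v j * v a
      = ∑ l, ∑ i, ∑ j, D l i j * v i * v j * v l := by
    rw [Finset.sum_comm]
    have : ∀ j, ∑ i, ∑ a, D a i j * v i * v j * v a = ∑ a, ∑ i, D a i j * v i * v j * v a :=
      fun j => Finset.sum_comm
    simp only [this]
    rw [Finset.sum_comm]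
    refine Finset.sum_congr rfl fun l _ => Finset.sum_comm
  calc _ = s / 2 * (∑ i, ∑ j, ∑ a, D i j a * v i * v j * v a
        + ∑ i, ∑ j, ∑ a, D j i a * v i * v j * v a
        - ∑ i, ∑ j, ∑ a, D a i j * v i * v j * v a) := by
        simp only [e1, ← Finset.sum_add_distrib, ← Finset.sum_sub_distrib]
        simp only [Finset.mul_sum, Finset.sum_mul]
        refine Finset.sum_congr rfl fun l _ => Finset.sum_congr rfl fun i _ =>
          Finset.sum_congr rfl fun j _ => by ring
    _ = _ := by rw [e2, e3, e4]; ring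

theorem aux_g_cc {m : ℕ} (c : (Fin (m + 1) → ℝ) → ℝ)
    (ghat : (Fin m → ℝ) → Matrix (Fin m) (Fin m) ℝ) (x : Fin (m + 1) → ℝ) (i j : Fin m) :
    gMet c ghat x i.castSucc j.castSucc = c x * ghat (proj x) i j := by
  simp [gMet]

theorem aux_g_cl {m : ℕ} (c : (Fin (m + 1) → ℝ) → ℝ)
    (ghat : (Fin m → ℝ) → Matrix (Fin m) (Fin m) ℝ) (x : Fin (m + 1) → ℝ) (i : Fin m) :
    gMet c ghat x i.castSucc (Fin.last m) = 0 := by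
  simp [gMet]

theorem aux_g_lc {m : ℕ} (c : (Fin (m + 1) → ℝ) → ℝ)
    (ghat : (Fin m → ℝ) → Matrix (Fin m) (Fin m) ℝ) (x : Fin (m + 1) → ℝ) (i : Fin m) :
    gMet c ghat x (Fin.last m) i.castSucc = 0 := by
  simp [gMet]

theorem aux_g_ll {m : ℕ} (c : (Fin (m + 1) → ℝ) → ℝ)
    (ghat : (Fin m → ℝ) → Matrix (Fin m) (Fin m) ℝ) (x : Fin (m + 1) → ℝ) :
    gMet c ghat x (Fin.last m) (Fin.last m) = c x := by
  simp [gMet]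

theorem aux_inv {m : ℕ} (c : (Fin (m + 1) → ℝ) → ℝ)
    (ghat : (Fin m → ℝ) → Matrix (Fin m) (Fin m) ℝ) (x : Fin (m + 1) → ℝ)
    (hc : c x ≠ 0) (hg : IsUnit (ghat (proj x)).det) :
    (gMet c ghat x)⁻¹ = gMet (fun y => (c y)⁻¹) (fun y => (ghat y)⁻¹) x := by
  apply Matrix.inv_eq_right_inv
  have hmul := Matrix.mul_nonsing_inv _ hg
  ext i j
  rw [Matrix.mul_apply, Fin.sum_univ_castSucc]
  refine Fin.lastCases ?_ (fun i => ?_) i <;> refine Fin.lastCases ?_ (fun j => ?_) j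
  · simp [aux_g_cc, aux_g_cl, aux_g_lc, aux_g_ll, hc]
  · simp [aux_g_cc, aux_g_cl, aux_g_lc, aux_g_ll, Matrix.one_apply,
      (Fin.castSucc_ne_last _).symm]
  · simp [aux_g_cc, aux_g_cl, aux_g_lc, aux_g_ll, Matrix.one_apply, Fin.castSucc_ne_last]
  · have h := congrFun (congrFun hmul i) j
    rw [Matrix.mul_apply] at h
    simp only [aux_g_cc, aux_g_cl, aux_g_lc, zero_mul, add_zero]
    have : ∀ k, c x * ghat (proj x) i k * ((c x)⁻¹ * (ghat (proj x))⁻¹ k j)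
        = ghat (proj x) i k * (ghat (proj x))⁻¹ k j := by
      intro k; field_simp
    simp only [this, h, Matrix.one_apply, Fin.castSucc_inj]

theorem aux_pd_mul {k : ℕ} (a b : (Fin k → ℝ) → ℝ) (x : Fin k → ℝ) (i : Fin k)
    (ha : DifferentiableAt ℝ a x) (hb : DifferentiableAt ℝ b x) :
    pd i (fun y => a y * b y) x = a x * pd i b x + pd i a x * b x := by
  unfold pd
  rw [fderiv_fun_mul ha hb]
  simp; ring

theorem aux_pd_zero {k : ℕ} (x : Fin k → ℝ) (i : Fin k) :
    pd i (fun _ => (0:ℝ)) x = 0 := by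
  simp [pd]

/-- cubic form of the derivative of the metric -/
theorem aux_D {m : ℕ} (c : (Fin (m + 1) → ℝ) → ℝ)
    (ghat : (Fin m → ℝ) → Matrix (Fin m) (Fin m) ℝ)
    (hghat : ∀ i j, Differentiable ℝ fun x' => ghat x' i j)
    (hc : Differentiable ℝ c) (x : Fin (m + 1) → ℝ) (w : Fin m → ℝ) (a t : ℝ)
    (v : Fin (m + 1) → ℝ) (hv : ∀ i, v (Fin.castSucc i) = a * w i) (ht : v (Fin.last m) = t) :
    ∑ l, ∑ i, ∑ j, pd l (fun y => gMet c ghat y i j) x * v i * v j * v l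
      = (a * ∑ l : Fin m, pd l.castSucc c x * w l + t * pd (Fin.last m) c x)
          * (a ^ 2 * (∑ i, ∑ j, ghat (proj x) i j * w i * w j) + t ^ 2)
        + a ^ 3 * c x * ∑ l, ∑ i, ∑ j, pd l (fun y => ghat y i j) (proj x) * w i * w j * w l := by
  have hd := fun i j => aux_diff_ext _ (hghat i j)
  have q : ∀ l, ∑ i, ∑ j, pd l (fun y => gMet c ghat y i j) x * v i * v j * v l
     = v l * (pd l c x * (a ^ 2 * (∑ i, ∑ j, ghat (proj x) i j * w i * w j) + t ^ 2)
       + a ^ 2 * c x * ∑ i, ∑ j, pd l (fun y => ghat (proj y) i j) x * w i * w j) := by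
    intro l
    simp only [Fin.sum_univ_castSucc, aux_g_cc, aux_g_cl, aux_g_lc, aux_g_ll, aux_pd_zero, hv, ht,
      aux_pd_mul c _ x l (hc x) (hd _ _ x)]
    simp only [zero_mul, add_zero, Finset.sum_const_zero, zero_add]
    have : ∑ i, ∑ j, (c x * pd l (fun y => ghat (proj y) i j) x + pd l c x * ghat (proj x) i j)
          * (a * w i) * (a * w j) * v l
        = v l * a ^ 2 * c x * (∑ i, ∑ j, pd l (fun y => ghat (proj y) i j) x * w i * w j)
          + v l * a ^ 2 * pd l c x * (∑ i, ∑ j, ghat (proj x) i j * w i * w j) := by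
      simp only [Finset.mul_sum, ← Finset.sum_add_distrib]
      refine Finset.sum_congr rfl fun i _ => Finset.sum_congr rfl fun j _ => by ring
    have h2 : ∀ α : ℝ, α = α := fun _ => rfl
    rw [this]; ring
  simp only [q]
  rw [Fin.sum_univ_castSucc]
  simp only [aux_pd_ext_cast _ (hghat _ _), aux_pd_ext_last _ (hghat _ _), hv, ht]
  simp only [zero_mul, Finset.sum_const_zero, mul_zero, add_zero]
  generalize (a ^ 2 * (∑ i, ∑ j, ghat (proj x) i j * w i * w j) + t ^ 2) = Q
  have h3 : ∀ l, ∑ i, ∑ j, pd l (fun y => ghat y i j) (proj x) * w i * w j * w l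
      = (∑ i, ∑ j, pd l (fun y => ghat y i j) (proj x) * w i * w j) * w l := by
    intro l; simp only [Finset.sum_mul]
  simp only [h3]
  generalize (fun l => ∑ i, ∑ j, pd l (fun y => ghat y i j) (proj x) * w i * w j) = R
  rw [add_mul, add_right_comm]
  congr 1
  · simp only [Finset.mul_sum, Finset.sum_mul, ← Finset.sum_add_distrib]
    refine Finset.sum_congr rfl fun i _ => ?_
    try simp only [← Finset.mul_sum, ← Finset.sum_mul]
    ring
  · ring

/-- For `f(x', x_n) = x_n − u(x')` one has
`c² (∇²_g f)(∇_g f, ∇_g f) = (1/(2c)) ĝ^{mr} ∂_r c ∂_m u − (1/(2c)) ∂_n c (1 + |∇_ĝ u|²_ĝ)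
  − (∇²_g u)(∇_ĝ u, ∇_ĝ u)`, where `n = m+1`. -/
theorem hessian_grad_grad_graph (m : ℕ) (hm : 2 ≤ m)
    (ghat : (Fin m → ℝ) → Matrix (Fin m) (Fin m) ℝ)
    (hghat : ∀ i j, ContDiff ℝ (⊤ : ℕ∞) fun x' => ghat x' i j)
    (hpd : ∀ x', (ghat x').PosDef)
    (c : (Fin (m + 1) → ℝ) → ℝ)
    (hc : ContDiff ℝ (⊤ : ℕ∞) c) (hcpos : ∀ x, 0 < c x)
    (u : (Fin m → ℝ) → ℝ) (hu : ContDiff ℝ 2 u)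
    (x : Fin (m + 1) → ℝ) :
    c x ^ 2 * ∑ i : Fin (m + 1), ∑ j : Fin (m + 1),
        hessian (gMet c ghat) (fun y => y (Fin.last m) - ext u y) i j x
          * gradC (gMet c ghat) (fun y => y (Fin.last m) - ext u y) i x
          * gradC (gMet c ghat) (fun y => y (Fin.last m) - ext u y) j x
      = (1 / (2 * c x)) *
            ∑ mm : Fin m, ∑ r : Fin m,
              (ghat (proj x))⁻¹ mm r * pd (Fin.castSucc r) c x * pd mm u (proj x)
        - (1 / (2 * c x)) * pd (Fin.last m) c x * (1 + gradSq ghat u (proj x))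
        - ∑ i : Fin m, ∑ j : Fin m,
            hessian (gMet c ghat) (ext u) (Fin.castSucc i) (Fin.castSucc j) x
              * gradC ghat u i (proj x) * gradC ghat u j (proj x) := by
  have hG : Differentiable ℝ u := hu.differentiable (by norm_num)
  have hgd : ∀ i j, Differentiable ℝ fun x' => ghat x' i j :=
    fun i j => (hghat i j).differentiable (by simp)
  have hcd : Differentiable ℝ c := hc.differentiable (by simp)
  have hpu : ∀ j, Differentiable ℝ (pd j u) := by
    intro j
    have : Differentiable ℝ (fderiv ℝ u) :=
      (hu.fderiv_right (m := 1) (by norm_num)).differentiable (by norm_num)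
    exact fun y => (this y).clm_apply (differentiableAt_const _)
  have hcx : c x ≠ 0 := (hcpos x).ne'
  have hdet : IsUnit (ghat (proj x)).det := (hpd (proj x)).det_pos.ne'.isUnit
  have hinv := aux_inv c ghat x hcx hdet
  set G := (ghat (proj x))⁻¹ with hGdef
  have hGsym : ∀ i j, G i j = G j i := by
    intro i j
    have := (hpd (proj x)).isHermitian.inv.apply j i
    simpa using this
  set p : Fin m → ℝ := fun i => pd i u (proj x) with hp
  set w : Fin m → ℝ := fun i => gradC ghat u i (proj x) with hw
  have hwG : ∀ i, w i = ∑ j, G i j * p j := fun i => rfl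
  have hwG' : ∀ i, w i = ∑ j, G j i * p j := by
    intro i; rw [hwG]; exact Finset.sum_congr rfl fun j _ => by rw [hGsym]
  -- first derivatives
  have du_c : ∀ i : Fin m, pd i.castSucc (ext u) = fun y => pd i u (proj y) :=
    fun i => funext fun y => aux_pd_ext_cast u hG i y
  have du_l : pd (Fin.last m) (ext u) = fun _ => 0 :=
    funext fun y => aux_pd_ext_last u hG y
  have dxl : ∀ (i : Fin (m + 1)) y, pd i (fun y => y (Fin.last m) - ext u y) y
      = (Pi.single i (1:ℝ) : Fin (m + 1) → ℝ) (Fin.last m) - pd i (ext u) y := by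
    intro i y
    have h1 : HasFDerivAt (fun y : Fin (m + 1) → ℝ => y (Fin.last m))
      (ContinuousLinearMap.proj (R := ℝ) (φ := fun _ : Fin (m + 1) => ℝ) (Fin.last m)) y :=
      hasFDerivAt_apply _ _
    have h2 : HasFDerivAt (ext u) (fderiv ℝ (ext u) y) y :=
      (aux_diff_ext u hG y).hasFDerivAt
    unfold pd
    rw [(h1.fun_sub h2).fderiv]
    rfl
  have df_c : ∀ i : Fin m, pd i.castSucc (fun y => y (Fin.last m) - ext u y)
      = fun y => - pd i u (proj y) := by
    intro i; funext y
    rw [dxl, du_c]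
    simp [Pi.single_apply, (Fin.castSucc_ne_last _).symm]
  have df_l : pd (Fin.last m) (fun y => y (Fin.last m) - ext u y) = fun _ => 1 := by
    funext y
    rw [dxl, du_l]
    simp
  have pdneg : ∀ (i : Fin (m + 1)) (φ : (Fin (m + 1) → ℝ) → ℝ),
      pd i (fun y => - φ y) x = - pd i φ x := by
    intro i φ
    unfold pd
    rw [fderiv_fun_neg]; rfl
  have pdc : ∀ (i : Fin (m + 1)) (r : ℝ), pd i (fun _ => r) x = 0 := by
    intro i r; simp [pd]
  -- gradients
  let f : (Fin (m + 1) → ℝ) → ℝ := fun y => y (Fin.last m) - ext u y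
  let v : Fin (m + 1) → ℝ := Fin.lastCases 1 (fun i => -1 * w i)
  let v' : Fin (m + 1) → ℝ := Fin.lastCases 0 (fun i => 1 * w i)
  have v_c : ∀ i : Fin m, v i.castSucc = -1 * w i := fun i => by simp [v]
  have v_l : v (Fin.last m) = 1 := by simp [v]
  have v'_c : ∀ i : Fin m, v' i.castSucc = 1 * w i := fun i => by simp [v']
  have v'_l : v' (Fin.last m) = 0 := by simp [v']
  have grad : ∀ i, gradC (gMet c ghat) f i x = (c x)⁻¹ * v i := by
    intro i
    simp only [gradC, hinv, Fin.sum_univ_castSucc, f, df_c, df_l]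
    refine Fin.lastCases ?_ (fun i => ?_) i
    · simp [aux_g_lc, aux_g_ll, v_l]
    · simp only [aux_g_cc, aux_g_cl, v_c, hwG, Finset.mul_sum, zero_mul, add_zero]
      exact Finset.sum_congr rfl fun j _ => by simp only [hp, hGdef]; ring
  have hF : ∀ a, ∑ l, (gMet c ghat x)⁻¹ l a * pd l f x = (c x)⁻¹ * v a := by
    intro i
    simp only [hinv, Fin.sum_univ_castSucc, f, df_c, df_l]
    refine Fin.lastCases ?_ (fun i => ?_) i
    · simp [aux_g_cl, aux_g_ll, v_l]
    · simp only [aux_g_cc, aux_g_lc, v_c, hwG', Finset.mul_sum, zero_mul, add_zero]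
      exact Finset.sum_congr rfl fun j _ => by simp only [hp, hGdef]; ring
  have hF' : ∀ a, ∑ l, (gMet c ghat x)⁻¹ l a * pd l (ext u) x = (c x)⁻¹ * v' a := by
    intro i
    simp only [hinv, Fin.sum_univ_castSucc, du_c, du_l]
    refine Fin.lastCases ?_ (fun i => ?_) i
    · simp [aux_g_cl, aux_g_ll, v'_l]
    · simp only [aux_g_cc, aux_g_lc, v'_c, hwG', Finset.mul_sum, zero_mul, mul_zero, add_zero]
      exact Finset.sum_congr rfl fun j _ => by simp only [hp, hGdef]; ring
  have A := aux_christ (gMet c ghat) x (fun l => pd l f x) v _ hF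
  have A' := aux_christ (gMet c ghat) x (fun l => pd l (ext u) x) v' _ hF'
  rw [aux_D c ghat hgd hcd x w (-1) 1 v v_c v_l] at A
  rw [aux_D c ghat hgd hcd x w 1 0 v' v'_c v'_l] at A'
  -- second-derivative parts
  set S := ∑ i : Fin m, ∑ j : Fin m, pd i (pd j u) (proj x) * w i * w j with hS
  have B : ∑ i, ∑ j, pd i (pd j f) x * v i * v j = - S := by
    simp only [Fin.sum_univ_castSucc, f, df_c, df_l, pdneg, pdc, v_c, v_l,
      aux_pd_ext_cast _ (hpu _), aux_pd_ext_last _ (hpu _)]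
    simp only [hS, ← Finset.sum_neg_distrib, zero_mul, neg_zero, Finset.sum_const_zero, add_zero]
    exact Finset.sum_congr rfl fun i _ => Finset.sum_congr rfl fun j _ => by ring
  have L1 : c x ^ 2 * ∑ i, ∑ j, hessian (gMet c ghat) f i j x
      * gradC (gMet c ghat) f i x * gradC (gMet c ghat) f j x
      = - S - ∑ i, ∑ j, (∑ l, christoffel (gMet c ghat) l i j x * pd l f x) * v i * v j := by
    rw [← B]
    simp only [grad, hessian, ← Finset.sum_sub_distrib, Finset.mul_sum (Finset.univ)]
    refine Finset.sum_congr rfl fun i _ => Finset.sum_congr rfl fun j _ => ?_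
    field_simp
  have R1 : ∑ i : Fin m, ∑ j : Fin m,
            hessian (gMet c ghat) (ext u) (Fin.castSucc i) (Fin.castSucc j) x * w i * w j
      = S - ∑ i, ∑ j, (∑ l, christoffel (gMet c ghat) l i j x * pd l (ext u) x) * v' i * v' j := by
    rw [Fin.sum_univ_castSucc (n := m)]
    simp only [Fin.sum_univ_castSucc (n := m) (f := fun j => _ * v' j)]
    simp only [v'_c, v'_l, mul_zero, zero_mul, add_zero, Finset.sum_const_zero, one_mul, hS,
      ← Finset.sum_sub_distrib]
    refine Finset.sum_congr rfl fun i _ => Finset.sum_congr rfl fun j _ => ?_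
    simp only [hessian]
    rw [du_c, aux_pd_ext_cast _ (hpu _)]
    ring
  set N := ∑ i, ∑ j, ghat (proj x) i j * w i * w j with hN
  have hgw : ∀ i, ∑ j, ghat (proj x) i j * w j = p i := by
    intro i
    have : (ghat (proj x)).mulVec (G.mulVec p) = p := by
      rw [Matrix.mulVec_mulVec, hGdef, Matrix.mul_nonsing_inv _ hdet, Matrix.one_mulVec]
    exact congrFun this i
  have hNs : gradSq ghat u (proj x) = N := by
    have e1 : N = ∑ i, w i * p i := by
      rw [hN]
      refine Finset.sum_congr rfl fun i _ => ?_
      rw [← hgw i, Finset.mul_sum]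
      exact Finset.sum_congr rfl fun j _ => by ring
    rw [e1]
    unfold gradSq
    refine Finset.sum_congr rfl fun i _ => ?_
    rw [hwG, Finset.sum_mul]
    exact Finset.sum_congr rfl fun j _ => by simp only [hp, hGdef]; ring
  set C := ∑ l : Fin m, pd l.castSucc c x * w l with hC
  have hCs : ∑ mm : Fin m, ∑ r : Fin m, G mm r * pd (Fin.castSucc r) c x * pd mm u (proj x)
      = C := by
    rw [Finset.sum_comm, hC]
    refine Finset.sum_congr rfl fun r _ => ?_
    rw [hwG', Finset.mul_sum]
    exact Finset.sum_congr rfl fun j _ => by simp only [hp]; ring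
  rw [hNs, hCs]
  refine Eq.trans L1 ?_
  refine Eq.trans ?_ (congrArg _ R1.symm)
  rw [A, A']
  field_simp
  ring
end
end

section
/- Let n ≥ 3 and let g(x', x_n) = c(x', x_n)·blockdiag(ĝ(x'), 1) on ℝ^n as in the setup, and assume ∂_{x_n}c(x', 0) = 0 for all x' ∈ ℝ^{n−1}. Let ε ↦ u_ε be a family of functions ℝ^{n−1} → ℝ, smooth jointly in (x', ε) for ε in a neighborhood of 0 in ℝ, with u_0 ≡ 0, and let v := ∂_ε u_ε|_{ε=0}. Define F(x', u, ∇_g u, ∇²_g u) := (−Δ_ĝ u + ((1−n)/(2c)) ĝ^{mr}∂_{x_r}c ∂_{x_m}u + ((n−1)/(2c)) ∂_{x_n}c)(1 + |∇_ĝ u|²_ĝ) + (∇²_ĝ u)(∇_ĝ u, ∇_ĝ u), with c and its derivatives evaluated at (x', u_ε(x')). Then for every x' ∈ ℝ^{n−1}: ∂_ε[F(x', u_ε, ∇_g u_ε, ∇²_g u_ε)]|_{ε=0} = −Δ_ĝ v + ((n−1)/(2c(x', 0))) ∂²_{x_n}c(x', 0)·v + ((1−n)/(2c(x', 0))) Σ_{i,j=1}^{n−1}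 ĝ^{ij}(x') ∂_{x_i}c(x', 0) ∂_{x_j}v. -/
noncomputable section

open scoped BigOperators

/-- The quasilinear minimal surface operator
`F = (−Δ_ĝ u + ((1−n)/(2c)) ĝ^{mr} ∂_r c ∂_m u + ((n−1)/(2c)) ∂_n c)(1 + |∇_ĝ u|²_ĝ)
  + (∇²_ĝ u)(∇_ĝ u, ∇_ĝ u)`, where `n = m+1`, the spatial point is `x'` and the conformal
factor `c` and its derivatives are evaluated at the point `x ∈ ℝ^{m+1}`. -/
def Fop {m : ℕ} (c : (Fin (m + 1) → ℝ) → ℝ)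
    (ghat : (Fin m → ℝ) → Matrix (Fin m) (Fin m) ℝ)
    (u : (Fin m → ℝ) → ℝ) (x' : Fin m → ℝ) (x : Fin (m + 1) → ℝ) : ℝ :=
  (-(laplaceB ghat u x')
      + ((1 - ((m : ℝ) + 1)) / (2 * c x)) *
          ∑ mm : Fin m, ∑ r : Fin m, (ghat x')⁻¹ mm r * pd (Fin.castSucc r) c x * pd mm u x'
      + ((((m : ℝ) + 1) - 1) / (2 * c x)) * pd (Fin.last m) c x)
    * (1 + gradSq ghat u x')
  + ∑ i : Fin m, ∑ j : Fin m,
      hessian ghat u i j x' * gradC ghat u i x' * gradC ghat u j x'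

def SmFam {m : ℕ} (u : ℝ → (Fin m → ℝ) → ℝ) : Prop :=
  ∃ V : Set ℝ, IsOpen V ∧ (0:ℝ) ∈ V ∧
    ContDiffOn ℝ (⊤ : ℕ∞) (fun p : ℝ × (Fin m → ℝ) => u p.1 p.2) (V ×ˢ Set.univ)

lemma pd_slice {m : ℕ} (u : ℝ → (Fin m → ℝ) → ℝ) (j : Fin m) (e : ℝ) (y : Fin m → ℝ)
    (h : DifferentiableAt ℝ (fun p : ℝ × (Fin m → ℝ) => u p.1 p.2) (e, y)) :
    pd j (u e) y = fderiv ℝ (fun p : ℝ × (Fin m → ℝ) => u p.1 p.2) (e, y) (0, Pi.single j 1) := by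
  have h2 : HasFDerivAt (fun y : Fin m → ℝ => ((e, y) : ℝ × (Fin m → ℝ)))
      (ContinuousLinearMap.inr ℝ ℝ (Fin m → ℝ)) y := hasFDerivAt_prodMk_right e y
  have h3 := HasFDerivAt.comp y h.hasFDerivAt h2
  have h4 : HasFDerivAt (u e) _ y := h3
  unfold pd
  rw [h4.fderiv]
  simp

lemma deriv_slice {m : ℕ} (u : ℝ → (Fin m → ℝ) → ℝ) (e : ℝ) (y : Fin m → ℝ)
    (h : DifferentiableAt ℝ (fun p : ℝ × (Fin m → ℝ) => u p.1 p.2) (e, y)) :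
    HasDerivAt (fun e => u e y)
      (fderiv ℝ (fun p : ℝ × (Fin m → ℝ) => u p.1 p.2) (e, y) (1, 0)) e := by
  have h2 : HasDerivAt (fun e : ℝ => ((e, y) : ℝ × (Fin m → ℝ))) (1, 0) e :=
    (hasDerivAt_id e).prodMk (hasDerivAt_const e y)
  exact HasFDerivAt.comp_hasDerivAt (f := fun e : ℝ => ((e, y) : ℝ × (Fin m → ℝ)))
    (l := fun p : ℝ × (Fin m → ℝ) => u p.1 p.2) e h.hasFDerivAt h2

lemma SmFam.contDiffAt {m : ℕ} {u : ℝ → (Fin m → ℝ) → ℝ} {V : Set ℝ} (hV : IsOpen V)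
    (h : ContDiffOn ℝ (⊤ : ℕ∞) (fun p : ℝ × (Fin m → ℝ) => u p.1 p.2) (V ×ˢ Set.univ))
    {e : ℝ} (he : e ∈ V) (y : Fin m → ℝ) :
    ContDiffAt ℝ (⊤ : ℕ∞) (fun p : ℝ × (Fin m → ℝ) => u p.1 p.2) (e, y) :=
  h.contDiffAt ((hV.prod isOpen_univ).mem_nhds ⟨he, trivial⟩)

lemma SmFam.pd {m : ℕ} {u : ℝ → (Fin m → ℝ) → ℝ} (h : SmFam u) (j : Fin m) :
    SmFam (fun e => pd j (u e)) := by
  obtain ⟨V, hV, h0, h⟩ := h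
  refine ⟨V, hV, h0, ?_⟩
  have h1 := h.fderiv_of_isOpen (m := (⊤ : ℕ∞)) (hV.prod isOpen_univ) (by simp)
  refine (h1.clm_apply (contDiffOn_const (c := ((0, Pi.single j 1) : ℝ × (Fin m → ℝ))))).congr ?_
  rintro ⟨e, y⟩ ⟨he, -⟩
  exact pd_slice u j e y ((SmFam.contDiffAt hV h he y).differentiableAt (by simp))

lemma SmFam.hasDerivAt {m : ℕ} {u : ℝ → (Fin m → ℝ) → ℝ} (h : SmFam u) (y : Fin m → ℝ) :
    HasDerivAt (fun e => u e y) (deriv (fun e => u e y) 0) 0 := by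
  obtain ⟨V, hV, h0, h⟩ := h
  exact (deriv_slice u 0 y
    ((SmFam.contDiffAt hV h h0 y).differentiableAt (by simp))).differentiableAt.hasDerivAt

lemma SmFam.deriv_pd {m : ℕ} {u : ℝ → (Fin m → ℝ) → ℝ} (h : SmFam u) (j : Fin m)
    (y : Fin m → ℝ) :
    deriv (fun e => _root_.pd j (u e) y) 0 = _root_.pd j (fun z => deriv (fun e => u e z) 0) y := by
  obtain ⟨V, hV, h0, h⟩ := h
  set w := fun p : ℝ × (Fin m → ℝ) => u p.1 p.2 with hw
  have hd : ∀ e ∈ V, ∀ z, DifferentiableAt ℝ w (e, z) := fun e he z =>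
    (SmFam.contDiffAt hV h he z).differentiableAt (by simp)
  have hc := SmFam.contDiffAt hV h h0 y
  have hsym : IsSymmSndFDerivAt ℝ w (0, y) := hc.isSymmSndFDerivAt (by simp; exact WithTop.coe_le_coe.2 le_top)
  have hdd : DifferentiableAt ℝ (fderiv ℝ w) (0, y) :=
    (hc.fderiv_right (m := 1) (by exact WithTop.coe_le_coe.2 le_top)).differentiableAt (by simp)
  have e1 : (fun e => _root_.pd j (u e) y) =ᶠ[nhds 0]
      fun e => fderiv ℝ w (e, y) (0, Pi.single j 1) := by
    filter_upwards [hV.mem_nhds h0] with e he using pd_slice u j e y (hd e he y)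
  have e2 : (fun z => deriv (fun e => u e z) 0) = fun z => fderiv ℝ w (0, z) (1, 0) := by
    funext z; exact (deriv_slice u 0 z (hd 0 h0 z)).deriv
  rw [e1.deriv_eq, e2]
  have hA : DifferentiableAt ℝ (fun p : ℝ × (Fin m → ℝ) => fderiv ℝ w p (0, Pi.single j 1)) (0, y) :=
    hdd.clm_apply (differentiableAt_const _)
  have hB : DifferentiableAt ℝ (fun p : ℝ × (Fin m → ℝ) => fderiv ℝ w p (1, 0)) (0, y) :=
    hdd.clm_apply (differentiableAt_const _)
  rw [(deriv_slice (fun e z => fderiv ℝ w (e, z) (0, Pi.single j 1)) 0 y hA).deriv,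
    pd_slice (fun e z => fderiv ℝ w (e, z) (1, 0)) j 0 y hB]
  have k : ∀ a : ℝ × (Fin m → ℝ), ∀ b, fderiv ℝ (fun p : ℝ × (Fin m → ℝ) => fderiv ℝ w p a) (0, y) b
      = fderiv ℝ (fderiv ℝ w) (0, y) b a := by
    intro a b
    rw [fderiv_clm_apply hdd (differentiableAt_const _)]
    simp
  exact (k _ _).trans ((hsym _ _).trans (k _ _).symm)

lemma SmFam.hasDerivAt_pd {m : ℕ} {u : ℝ → (Fin m → ℝ) → ℝ} (h : SmFam u) (j : Fin m)
    (y : Fin m → ℝ) :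
    HasDerivAt (fun e => _root_.pd j (u e) y) (_root_.pd j (fun z => deriv (fun e => u e z) 0) y) 0 := by
  rw [← h.deriv_pd]; exact (h.pd j).hasDerivAt y

lemma SmFam.hasDerivAt_pd2 {m : ℕ} {u : ℝ → (Fin m → ℝ) → ℝ} (h : SmFam u) (i j : Fin m)
    (y : Fin m → ℝ) :
    HasDerivAt (fun e => _root_.pd i (_root_.pd j (u e)) y)
      (_root_.pd i (_root_.pd j (fun z => deriv (fun e => u e z) 0)) y) 0 := by
  have h1 := (h.pd j).hasDerivAt_pd i y
  have : (fun z => deriv (fun e => _root_.pd j (u e) z) 0)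
      = _root_.pd j (fun z => deriv (fun e => u e z) 0) := by
    funext z; exact h.deriv_pd j z
  rwa [this] at h1

lemma SmFam.hasDerivAt_hessian {m : ℕ} {u : ℝ → (Fin m → ℝ) → ℝ} (h : SmFam u)
    (g : (Fin m → ℝ) → Matrix (Fin m) (Fin m) ℝ) (i j : Fin m) (y : Fin m → ℝ) :
    HasDerivAt (fun e => hessian g (u e) i j y)
      (hessian g (fun z => deriv (fun e => u e z) 0) i j y) 0 := by
  unfold hessian
  exact (h.hasDerivAt_pd2 i j y).sub
    (HasDerivAt.fun_sum fun l _ => (h.hasDerivAt_pd l y).const_mul _)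

lemma SmFam.hasDerivAt_laplaceB {m : ℕ} {u : ℝ → (Fin m → ℝ) → ℝ} (h : SmFam u)
    (g : (Fin m → ℝ) → Matrix (Fin m) (Fin m) ℝ) (y : Fin m → ℝ) :
    HasDerivAt (fun e => laplaceB g (u e) y)
      (laplaceB g (fun z => deriv (fun e => u e z) 0) y) 0 := by
  unfold laplaceB
  exact HasDerivAt.fun_sum fun i _ => HasDerivAt.fun_sum fun j _ =>
    (h.hasDerivAt_hessian g i j y).const_mul _

lemma SmFam.hasDerivAt_gradC {m : ℕ} {u : ℝ → (Fin m → ℝ) → ℝ} (h : SmFam u)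
    (g : (Fin m → ℝ) → Matrix (Fin m) (Fin m) ℝ) (i : Fin m) (y : Fin m → ℝ) :
    HasDerivAt (fun e => gradC g (u e) i y)
      (gradC g (fun z => deriv (fun e => u e z) 0) i y) 0 := by
  unfold gradC
  exact HasDerivAt.fun_sum fun j _ => (h.hasDerivAt_pd j y).const_mul _

lemma pd_zero_fun {m : ℕ} (j : Fin m) : pd j (fun _ : Fin m → ℝ => (0:ℝ)) = fun _ => 0 := by
  funext y; simp [pd]

lemma hasDerivAt_snoc_last {m : ℕ} (x' : Fin m → ℝ) (t : ℝ) :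
    HasDerivAt (fun t : ℝ => (Fin.snoc x' t : Fin (m+1) → ℝ)) (Pi.single (Fin.last m) 1) t := by
  rw [hasDerivAt_pi]
  intro i
  refine Fin.lastCases ?_ (fun i => ?_) i
  · simpa using hasDerivAt_id' t
  · simpa using hasDerivAt_const t (x' i)

lemma hasDerivAt_comp_snoc {m : ℕ} (f : (Fin (m+1) → ℝ) → ℝ) (x' : Fin m → ℝ) (q : ℝ → ℝ) (q' : ℝ)
    (hq : HasDerivAt q q' 0) (hf : Differentiable ℝ f) :
    HasDerivAt (fun e => f (Fin.snoc x' (q e) : Fin (m+1) → ℝ))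
      (pd (Fin.last m) f (Fin.snoc x' (q 0)) * q') 0 := by
  have h1 : HasDerivAt (fun t => f (Fin.snoc x' t : Fin (m+1) → ℝ))
      (pd (Fin.last m) f (Fin.snoc x' (q 0))) (q 0) :=
    HasFDerivAt.comp_hasDerivAt (q 0) (hf _).hasFDerivAt (hasDerivAt_snoc_last x' (q 0))
  exact HasDerivAt.comp (h₂ := fun t => f (Fin.snoc x' t : Fin (m+1) → ℝ)) (h := q) 0 h1 hq

/-- First linearization of the minimal surface equation at the zero solution: if
`∂_n c(x', 0) = 0`, `u_ε` is a smooth family with `u_0 ≡ 0` and `v = ∂_ε u_ε|_{ε=0}`, then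
`∂_ε[F(x', u_ε, ∇ u_ε, ∇² u_ε)]|_{ε=0}
  = −Δ_ĝ v + ((n−1)/(2c(x',0))) ∂²_n c(x',0) v
    + ((1−n)/(2c(x',0))) Σ_{i,j} ĝ^{ij} ∂_i c(x',0) ∂_j v`, where `n = m+1`. -/
theorem first_linearization_mse (m : ℕ) (hm : 2 ≤ m)
    (ghat : (Fin m → ℝ) → Matrix (Fin m) (Fin m) ℝ)
    (hghat : ∀ i j, ContDiff ℝ (⊤ : ℕ∞) fun x' => ghat x' i j)
    (hpd : ∀ x', (ghat x').PosDef)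
    (c : (Fin (m + 1) → ℝ) → ℝ)
    (hc : ContDiff ℝ (⊤ : ℕ∞) c) (hcpos : ∀ x, 0 < c x)
    (hcn : ∀ x' : Fin m → ℝ, pd (Fin.last m) c (Fin.snoc x' (0 : ℝ)) = 0)
    (u : ℝ → (Fin m → ℝ) → ℝ)
    (hu : ∃ U ∈ nhds (0 : ℝ),
      ContDiffOn ℝ (⊤ : ℕ∞) (fun p : ℝ × (Fin m → ℝ) => u p.1 p.2) (U ×ˢ Set.univ))
    (hu0 : u 0 = fun _ => 0)
    (x' : Fin m → ℝ) :
    deriv (fun ε : ℝ => Fop c ghat (u ε) x' (Fin.snoc x' (u ε x'))) 0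
      = -(laplaceB ghat (fun y => deriv (fun ε : ℝ => u ε y) 0) x')
        + ((((m : ℝ) + 1) - 1) / (2 * c (Fin.snoc x' (0 : ℝ))))
            * pd (Fin.last m) (pd (Fin.last m) c) (Fin.snoc x' (0 : ℝ))
            * deriv (fun ε : ℝ => u ε x') 0
        + ((1 - ((m : ℝ) + 1)) / (2 * c (Fin.snoc x' (0 : ℝ)))) *
            ∑ i : Fin m, ∑ j : Fin m,
              (ghat x')⁻¹ i j * pd (Fin.castSucc i) c (Fin.snoc x' (0 : ℝ))
                * pd j (fun y => deriv (fun ε : ℝ => u ε y) 0) x' := by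
  obtain ⟨U, hU, hu⟩ := hu
  obtain ⟨V, hVU, hV, h0⟩ := mem_nhds_iff.1 hU
  have hs : SmFam u := ⟨V, hV, h0, hu.mono (Set.prod_mono hVU le_rfl)⟩
  clear hu
  have hu00 : u 0 x' = 0 := by rw [hu0]
  set v : (Fin m → ℝ) → ℝ := fun y => deriv (fun ε : ℝ => u ε y) 0 with hv
  have hq : HasDerivAt (fun ε => u ε x') (v x') 0 := hs.hasDerivAt x'
  have hpdc : ∀ i, Differentiable ℝ (pd i c) := fun i => by
    have : ContDiff ℝ 1 (pd i c) :=
      (hc.fderiv_right (m := 1) (by exact WithTop.coe_le_coe.2 le_top)).clm_apply contDiff_const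
    exact this.differentiable (by simp)
  have Hc := hasDerivAt_comp_snoc c x' _ _ hq (hc.differentiable (by simp))
  have Hpc := fun i => hasDerivAt_comp_snoc (pd i c) x' _ _ hq (hpdc i)
  have hc0 : (2 * c (Fin.snoc x' (u 0 x'))) ≠ 0 := (mul_pos two_pos (hcpos _)).ne'
  have pz : ∀ j : Fin m, pd j (u 0) x' = 0 := fun j => by rw [hu0, pd_zero_fun]
  have pzz : ∀ i j : Fin m, pd i (pd j (u 0)) x' = 0 := fun i j => by
    rw [hu0, pd_zero_fun, pd_zero_fun]
  have hL0 : laplaceB ghat (u 0) x' = 0 := by simp [laplaceB, pz, pzz]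
  have hG0 : ∀ i, gradC ghat (u 0) i x' = 0 := by simp [gradC, pz]
  have hQ0 : gradSq ghat (u 0) x' = 0 := by simp [gradSq, pz]
  have HL := hs.hasDerivAt_laplaceB ghat x'
  have HQ : HasDerivAt (fun ε => 1 + gradSq ghat (u ε) x') 0 0 := by
    unfold gradSq
    have := (HasDerivAt.fun_sum (u := Finset.univ) fun i _ =>
      HasDerivAt.fun_sum (u := Finset.univ) fun j _ =>
      (((hs.hasDerivAt_pd i x').const_mul ((ghat x')⁻¹ i j)).mul (hs.hasDerivAt_pd j x'))).const_add 1
    refine this.congr_deriv ?_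
    simp [pz]
  have HH : HasDerivAt (fun ε => ∑ i : Fin m, ∑ j : Fin m,
      hessian ghat (u ε) i j x' * gradC ghat (u ε) i x' * gradC ghat (u ε) j x') 0 0 := by
    have := (HasDerivAt.fun_sum (u := Finset.univ) fun i _ =>
      HasDerivAt.fun_sum (u := Finset.univ) fun j _ =>
      (((hs.hasDerivAt_hessian ghat i j x').mul (hs.hasDerivAt_gradC ghat i x')).mul
        (hs.hasDerivAt_gradC ghat j x')))
    refine this.congr_deriv ?_
    simp [hG0]
  have HS : HasDerivAt (fun ε => ∑ mm : Fin m, ∑ r : Fin m, (ghat x')⁻¹ mm r *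
      pd (Fin.castSucc r) c (Fin.snoc x' (u ε x')) * pd mm (u ε) x')
      (∑ mm : Fin m, ∑ r : Fin m, (ghat x')⁻¹ mm r *
        pd (Fin.castSucc r) c (Fin.snoc x' (0 : ℝ)) * pd mm v x') 0 := by
    have := (HasDerivAt.fun_sum (u := Finset.univ) fun mm _ =>
      HasDerivAt.fun_sum (u := Finset.univ) fun r _ =>
      (((Hpc (Fin.castSucc r)).const_mul ((ghat x')⁻¹ mm r)).mul (hs.hasDerivAt_pd mm x')))
    refine this.congr_deriv ?_
    simp [pz, hu00, hv]
  have HK : ∀ k : ℝ, HasDerivAt (fun ε => k / (2 * c (Fin.snoc x' (u ε x')))) _ 0 := fun k =>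
    (hasDerivAt_const (0:ℝ) k).div (Hc.const_mul 2) hc0
  have HP := ((HL.neg.add ((HK (1 - ((m : ℝ) + 1))).mul HS)).add
    ((HK (((m : ℝ) + 1) - 1)).mul (Hpc (Fin.last m))))
  have HF := (HP.mul HQ).add HH
  have hsymm : ∑ mm : Fin m, ∑ r : Fin m, (ghat x')⁻¹ mm r *
        pd (Fin.castSucc r) c (Fin.snoc x' (0 : ℝ)) * pd mm v x'
      = ∑ i : Fin m, ∑ j : Fin m,
              (ghat x')⁻¹ i j * pd (Fin.castSucc i) c (Fin.snoc x' (0 : ℝ)) * pd j v x' := by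
    rw [Finset.sum_comm]
    refine Finset.sum_congr rfl fun i _ => Finset.sum_congr rfl fun j _ => ?_
    have := (hpd x').isHermitian.inv.apply i j
    simp only [star_trivial] at this
    rw [this]
  rw [← hsymm]
  refine (HasDerivAt.deriv (f := fun ε : ℝ => Fop c ghat (u ε) x' (Fin.snoc x' (u ε x'))) HF).trans ?_
  simp only [Pi.add_apply, Pi.mul_apply, Pi.neg_apply, pz, hQ0, hu00, hcn, mul_zero,
    Finset.sum_const_zero, add_zero, zero_add, mul_one]
  ring
end
end
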